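/- Fix δ ∈ (0,1) and εmax ∈ (0,1/3]. There exist a constant C > 0 and an integer N ≥ 1, both depending only on δ and εmax, such that for every n ≥ N there exists a confidence-interval procedure (l,u) on n samples (depending on n, δ, εmax but NOT on σ) with the following property: for every θ ∈ ℝ, every σ > 0, every ε ∈ [0, εmax], and every probability measure Q on ℝ, letting r̄ = C·σ·( n^{-1/8} + ε^{1/4} / √(max(1, log(e·n·ε²))) ) (with the convention that the second summand is 0 when ε = 0), one has P_{θ,σ,ε,Q}^{⊗n}( { x ∈ ℝⁿ : l(x) ≤ θ ≤ u(x) and u(x) − l(x) ≤ r̄ } ) ≥ 1 − δ. -/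

import Mathlib

open MeasureTheory ProbabilityTheory Real
open scoped ENNReal NNReal

/-- Gaussian measure on `ℝ` with mean `m` and variance `v`. -/
noncomputable def gauss (m v : ℝ) : Measure ℝ := gaussianReal m (Real.toNNReal v)

/-- Efron's Gaussian two-groups model:
`(1-ε)·N(θ,σ²) + ε·(Q ∗ N(0,σ²))`. -/
noncomputable def efron (θ σ ε : ℝ) (Q : Measure ℝ) : Measure ℝ :=
  (ENNReal.ofReal (1 - ε)) • gauss θ (σ ^ 2) +
    (ENNReal.ofReal ε) • (Measure.conv Q (gauss 0 (σ ^ 2)))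

/-- The `n`-fold product (i.i.d.) measure on `ℝⁿ`. -/
noncomputable def iid (n : ℕ) (P : Measure ℝ) : Measure (Fin n → ℝ) :=
  Measure.pi fun _ => P

instance isProbabilityMeasure_gauss (m v : ℝ) : IsProbabilityMeasure (gauss m v) := by
  unfold gauss; infer_instance

theorem isProbabilityMeasure_efron {θ σ ε : ℝ} {Q : Measure ℝ} [IsProbabilityMeasure Q]
    (h0 : 0 ≤ ε) (h1 : ε ≤ 1) : IsProbabilityMeasure (efron θ σ ε Q) := by
  constructor
  simp only [efron, Measure.coe_add, Measure.coe_smul, Pi.add_apply, Pi.smul_apply, measure_univ,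
    smul_eq_mul, mul_one]
  rw [← ENNReal.ofReal_add (by linarith) h0]
  simp

/-! ### Integrals against the two-groups model -/

theorem integral_cos_gauss {σ : ℝ} (m t b : ℝ) :
    ∫ x, cos (t * x + b) ∂(gauss m (σ ^ 2)) = exp (-(σ ^ 2 * t ^ 2) / 2) * cos (t * m + b) := by
  have h := charFun_gaussianReal (μ := m) (v := (σ ^ 2).toNNReal) t
  rw [charFun_apply_real] at h
  have h2 : ∀ x : ℝ, cos (t * x + b)
      = RCLike.re (Complex.exp (b * Complex.I) * Complex.exp (t * x * Complex.I)) := by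
    intro x
    rw [← Complex.exp_add, show (b * Complex.I + t * x * Complex.I : ℂ)
      = ((t * x + b : ℝ) : ℂ) * Complex.I by push_cast; ring]
    rw [RCLike.re_eq_complex_re, Complex.exp_ofReal_mul_I_re]
  simp_rw [h2]
  have hint : Integrable (fun x : ℝ => Complex.exp (b * Complex.I) * Complex.exp (t * x * Complex.I))
      (gauss m (σ ^ 2)) := by
    refine Integrable.const_mul ?_ _
    refine (integrable_const (1 : ℝ)).mono' (by fun_prop) (ae_of_all _ fun x => ?_)
    rw [show (t * x * Complex.I : ℂ) = ((t * x : ℝ) : ℂ) * Complex.I by push_cast; ring,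
      Complex.norm_exp_ofReal_mul_I]
  rw [integral_re hint, integral_const_mul]
  unfold gauss
  rw [h, ← Complex.exp_add, ← Complex.exp_add]
  rw [Real.coe_toNNReal _ (sq_nonneg σ)]
  rw [show (b * Complex.I + (t * m * Complex.I - ((σ ^ 2 : ℝ) : ℂ) * t ^ 2 / 2) : ℂ)
    = ((-(σ ^ 2 * t ^ 2) / 2 : ℝ) : ℂ) + ((t * m + b : ℝ) : ℂ) * Complex.I by push_cast; ring]
  rw [show (b * Complex.I + (t * m * Complex.I) : ℂ)
    = ((t * m + b : ℝ) : ℂ) * Complex.I by push_cast; ring]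
  rw [Complex.exp_add, ← Complex.ofReal_exp]
  simp only [RCLike.re_eq_complex_re, Complex.re_ofReal_mul, Complex.exp_ofReal_mul_I_re]

theorem integral_efron {θ σ ε : ℝ} {Q : Measure ℝ} [IsProbabilityMeasure Q]
    (h0 : 0 ≤ ε) (h1 : ε ≤ 1) {f : ℝ → ℝ} (hf : Measurable f) {M : ℝ} (hM : ∀ x, |f x| ≤ M) :
    ∫ x, f x ∂(efron θ σ ε Q) = (1 - ε) * ∫ x, f x ∂(gauss θ (σ ^ 2))
      + ε * ∫ y, ∫ z, f (y + z) ∂(gauss 0 (σ ^ 2)) ∂Q := by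
  have hint : ∀ (ν : Measure ℝ) [IsFiniteMeasure ν], Integrable f ν := fun ν _ =>
    (integrable_const M).mono' hf.aestronglyMeasurable (ae_of_all _ hM)
  unfold efron
  rw [integral_add_measure ((hint _).smul_measure ENNReal.ofReal_ne_top)
    ((hint _).smul_measure ENNReal.ofReal_ne_top), integral_smul_measure, integral_smul_measure,
    integral_conv (hint _), ENNReal.toReal_ofReal (by linarith), ENNReal.toReal_ofReal h0]
  rfl

theorem integral_cos_efron {θ σ ε : ℝ} {Q : Measure ℝ} [IsProbabilityMeasure Q]
    (h0 : 0 ≤ ε) (h1 : ε ≤ 1) (t a : ℝ) :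
    ∫ x, cos (t * (x - a)) ∂(efron θ σ ε Q) = exp (-(σ ^ 2 * t ^ 2) / 2) *
      ((1 - ε) * cos (t * (θ - a)) + ε * ∫ y, cos (t * (y - a)) ∂Q) := by
  rw [integral_efron h0 h1 (by fun_prop) (M := 1) (fun x => abs_cos_le_one _)]
  have e1 := integral_cos_gauss (σ := σ) θ t (-(t * a))
  have e2 : ∀ y, ∫ z, cos (t * (y + z - a)) ∂(gauss 0 (σ ^ 2))
      = exp (-(σ ^ 2 * t ^ 2) / 2) * cos (t * (y - a)) := by
    intro y
    have := integral_cos_gauss (σ := σ) 0 t (t * (y - a))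
    rw [show t * 0 + t * (y - a) = t * (y - a) by ring] at this
    rw [← this]
    congr 1; ext z; ring_nf
  simp_rw [e2, integral_const_mul]
  rw [show t * (θ - a) = t * θ + -(t * a) by ring]
  have e3 : ∫ x, cos (t * (x - a)) ∂(gauss θ (σ ^ 2))
     = ∫ x, cos (t * x + -(t * a)) ∂(gauss θ (σ ^ 2)) := by
    congr 1; ext z; ring_nf
  rw [e3, e1]
  ring

/-- Mass of short intervals. -/
theorem efron_Icc_le {θ σ ε : ℝ} {Q : Measure ℝ} [IsProbabilityMeasure Q] (hσ : 0 < σ)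
    (h0 : 0 ≤ ε) (h1 : ε ≤ 1) (x c : ℝ) :
    efron θ σ ε Q (Set.Icc (x - c * σ) (x + c * σ)) ≤ ENNReal.ofReal c := by
  have key : ∀ m a : ℝ, gauss m (σ ^ 2) (Set.Icc (a - c * σ) (a + c * σ)) ≤ ENNReal.ofReal c := by
    intro m a
    have hv : (σ ^ 2).toNNReal ≠ 0 := by
      rw [Ne, Real.toNNReal_eq_zero, not_le]; positivity
    unfold gauss
    rw [gaussianReal_apply _ hv]
    have hpdf : ∀ y, gaussianPDF m (σ ^ 2).toNNReal y ≤ ENNReal.ofReal (1 / (2 * σ)) := by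
      intro y
      unfold gaussianPDF
      apply ENNReal.ofReal_le_ofReal
      unfold gaussianPDFReal
      rw [Real.coe_toNNReal _ (sq_nonneg σ)]
      have hs : 2 * σ ≤ √(2 * π * σ ^ 2) := by
        apply Real.le_sqrt_of_sq_le
        nlinarith [Real.pi_gt_three, sq_nonneg σ, mul_pos hσ hσ]
      have he : exp (-(y - m) ^ 2 / (2 * σ ^ 2)) ≤ 1 := by
        apply Real.exp_le_one_iff.2
        apply div_nonpos_of_nonpos_of_nonneg
        · nlinarith [sq_nonneg (y - m)]
        · positivity
      calc _ ≤ (√(2 * π * σ ^ 2))⁻¹ * 1 := by gcongr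
        _ ≤ _ := by
          rw [mul_one, one_div]
          exact inv_anti₀ (by positivity) hs
    calc _ ≤ ∫⁻ _ in Set.Icc (a - c * σ) (a + c * σ), ENNReal.ofReal (1 / (2 * σ)) :=
          lintegral_mono fun y => hpdf y
      _ = ENNReal.ofReal c := by
          rw [lintegral_const, Measure.restrict_apply MeasurableSet.univ, Set.univ_inter,
            Real.volume_Icc, ← ENNReal.ofReal_mul (by positivity)]
          congr 1
          field_simp
          ring
  have hconv : (Measure.conv Q (gauss 0 (σ ^ 2))) (Set.Icc (x - c * σ) (x + c * σ))
      ≤ ENNReal.ofReal c := by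
    rw [← lintegral_indicator_one measurableSet_Icc, Measure.lintegral_conv
      (measurable_one.indicator measurableSet_Icc)]
    calc _ ≤ ∫⁻ _, ENNReal.ofReal c ∂Q := by
          apply lintegral_mono
          intro y
          refine le_trans (le_of_eq ?_) (key 0 (x - y))
          rw [← lintegral_indicator_one (μ := gauss 0 (σ ^ 2)) measurableSet_Icc]
          refine lintegral_congr fun z => ?_
          simp only [Set.indicator, Set.mem_Icc, Pi.one_apply]
          congr 1
          apply propext
          constructor <;> rintro ⟨_, _⟩ <;> constructor <;> linarith
      _ = _ := by simp
  simp only [efron, Measure.coe_add, Measure.coe_smul, Pi.add_apply, Pi.smul_apply, smul_eq_mul]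
  calc _ ≤ ENNReal.ofReal (1 - ε) * ENNReal.ofReal c + ENNReal.ofReal ε * ENNReal.ofReal c := by
        gcongr
        exact key _ _
    _ = _ := by
      rw [← add_mul, ← ENNReal.ofReal_add (by linarith) h0]
      simp

/-- At least five eighths of the mass lies near the center. -/
theorem le_efron_Icc_center {θ σ ε : ℝ} {Q : Measure ℝ} [IsProbabilityMeasure Q] (hσ : 0 < σ)
    (h0 : 0 ≤ ε) (h1 : ε ≤ 1 / 3) :
    5 / 8 ≤ (efron θ σ ε Q).real {x | |x - θ| ≤ 4 * σ} := by
  have hp := isProbabilityMeasure_efron (θ := θ) (σ := σ) (Q := Q) h0 (by linarith)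
  have hcheb : gauss θ (σ ^ 2) {x | 4 * σ ≤ |x - θ|} ≤ ENNReal.ofReal (1 / 16) := by
    have h := meas_ge_le_variance_div_sq (μ := gauss θ (σ ^ 2)) (X := id)
      (memLp_id_gaussianReal 2) (c := 4 * σ) (by positivity)
    unfold gauss at h ⊢
    rw [variance_id_gaussianReal, Real.coe_toNNReal _ (sq_nonneg σ)] at h
    simp only [id, integral_id_gaussianReal] at h
    refine h.trans (le_of_eq ?_)
    congr 1; field_simp; norm_num
  have hms : MeasurableSet {x : ℝ | |x - θ| ≤ 4 * σ} :=
    measurableSet_le (by fun_prop) measurable_const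
  have hg : 15 / 16 ≤ (gauss θ (σ ^ 2)).real {x | |x - θ| ≤ 4 * σ} := by
    have hc := measureReal_compl (μ := gauss θ (σ ^ 2)) hms
    have hle : (gauss θ (σ ^ 2)).real {x | |x - θ| ≤ 4 * σ}ᶜ ≤ 1 / 16 := by
      have : (gauss θ (σ ^ 2)) {x | |x - θ| ≤ 4 * σ}ᶜ ≤ ENNReal.ofReal (1 / 16) := by
        refine (measure_mono ?_).trans hcheb
        intro x hx
        simp only [Set.mem_compl_iff, Set.mem_ofPred_eq, not_le] at hx ⊢
        exact hx.le
      exact ENNReal.toReal_le_of_le_ofReal (by norm_num) this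
    rw [hc] at hle
    simp at hle
    linarith
  have : (efron θ σ ε Q).real {x | |x - θ| ≤ 4 * σ}
      = (1 - ε) * (gauss θ (σ ^ 2)).real {x | |x - θ| ≤ 4 * σ}
        + ε * (Measure.conv Q (gauss 0 (σ ^ 2))).real {x | |x - θ| ≤ 4 * σ} := by
    unfold efron
    rw [measureReal_add_apply (by simp [ENNReal.mul_eq_top]) (by simp [ENNReal.mul_eq_top]), measureReal_ennreal_smul_apply, measureReal_ennreal_smul_apply,
      ENNReal.toReal_ofReal (by linarith), ENNReal.toReal_ofReal h0]
  rw [this]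
  have := measureReal_nonneg (μ := Measure.conv Q (gauss 0 (σ ^ 2))) (s := {x | |x - θ| ≤ 4 * σ})
  nlinarith

/-! ### The population statistic -/

/-- Mean of `x ↦ cos (t (x - a))`. -/
noncomputable def cosMean (P : Measure ℝ) (t a : ℝ) : ℝ := ∫ x, cos (t * (x - a)) ∂P

/-- A variance-free contrast of the characteristic function at frequencies `t` and `2t`,
centered at `a`. It is invariant in sign under convolution with centered Gaussians. -/
noncomputable def cosContrast (P : Measure ℝ) (t a : ℝ) : ℝ :=
  cosMean P (2 * t) a - cosMean P t a ^ 4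

theorem abs_cosMean_le_one (P : Measure ℝ) [IsProbabilityMeasure P] (t a : ℝ) :
    |cosMean P t a| ≤ 1 := by
  have := norm_integral_le_of_norm_le_const (μ := P) (f := fun x => cos (t * (x - a))) (C := 1)
    (ae_of_all _ fun x => abs_cos_le_one _)
  simpa [cosMean] using this

theorem cosContrast_efron {θ σ ε : ℝ} {Q : Measure ℝ} [IsProbabilityMeasure Q]
    (h0 : 0 ≤ ε) (h1 : ε ≤ 1) (t a : ℝ) :
    cosContrast (efron θ σ ε Q) t a = exp (-(2 * σ ^ 2 * t ^ 2)) *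
      ((1 - ε) * cos (2 * (t * (θ - a))) + ε * cosMean Q (2 * t) a
        - ((1 - ε) * cos (t * (θ - a)) + ε * cosMean Q t a) ^ 4) := by
  unfold cosContrast cosMean
  rw [integral_cos_efron h0 h1, integral_cos_efron h0 h1, mul_pow (exp _), ← Real.exp_nat_mul]
  rw [show -(σ ^ 2 * (2 * t) ^ 2) / 2 = -(2 * σ ^ 2 * t ^ 2) by ring,
    show ((4 : ℕ) : ℝ) * (-(σ ^ 2 * t ^ 2) / 2) = -(2 * σ ^ 2 * t ^ 2) by push_cast; ring,
    show 2 * t * (θ - a) = 2 * (t * (θ - a)) by ring]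
  ring

theorem cosContrast_center_nonneg {θ σ ε : ℝ} {Q : Measure ℝ} [IsProbabilityMeasure Q]
    (h0 : 0 ≤ ε) (h1 : ε ≤ 1 / 3) (t : ℝ) : 0 ≤ cosContrast (efron θ σ ε Q) t θ := by
  rw [cosContrast_efron h0 (by linarith)]
  apply mul_nonneg (exp_pos _).le
  have hint : ∀ s : ℝ, Integrable (fun y => cos (s * (y - θ))) Q := fun s =>
    (integrable_const (1 : ℝ)).mono' (by fun_prop) (ae_of_all _ fun x => abs_cos_le_one _)
  have hsqi : Integrable (fun y => cos (t * (y - θ)) ^ 2) Q :=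
    (integrable_const (1 : ℝ)).mono' (by fun_prop) (ae_of_all _ fun x => by
      rw [Real.norm_of_nonneg (sq_nonneg _)]; exact cos_sq_le_one _)
  have hdouble : cosMean Q (2 * t) θ = 2 * (∫ y, cos (t * (y - θ)) ^ 2 ∂Q) - 1 := by
    unfold cosMean
    have : ∀ y, cos (2 * t * (y - θ)) = 2 * cos (t * (y - θ)) ^ 2 - 1 := fun y => by
      rw [mul_assoc, cos_two_mul]
    simp_rw [this]
    rw [integral_sub (hsqi.const_mul 2) (integrable_const _), integral_const_mul]
    simp
  have hcs : (cosMean Q t θ) ^ 2 ≤ ∫ y, cos (t * (y - θ)) ^ 2 ∂Q := by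
    set c := cosMean Q t θ with hc
    have h2 : 0 ≤ ∫ y, (cos (t * (y - θ)) - c) ^ 2 ∂Q := integral_nonneg fun y => sq_nonneg _
    have h3 : ∀ y, (cos (t * (y - θ)) - c) ^ 2
        = cos (t * (y - θ)) ^ 2 - 2 * c * cos (t * (y - θ)) + c ^ 2 := fun y => by ring
    simp_rw [h3] at h2
    have hsub : Integrable (fun y => cos (t * (y - θ)) ^ 2 - 2 * c * cos (t * (y - θ))) Q :=
      hsqi.sub ((hint t).const_mul _)
    rw [integral_add hsub (integrable_const _),
      integral_sub hsqi ((hint t).const_mul _), integral_const_mul] at h2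
    change 0 ≤ (∫ y, cos (t * (y - θ)) ^ 2 ∂Q) - 2 * c * c + _ at h2
    simp at h2
    linarith
  have hb := abs_le.1 (abs_cosMean_le_one Q t θ)
  rw [hdouble]
  set q := ∫ y, cos (t * (y - θ)) ^ 2 ∂Q
  set c := cosMean Q t θ
  simp only [sub_self, mul_zero, cos_zero, mul_one]
  have hm0 : 0 ≤ ε * (1 - c) := mul_nonneg h0 (by linarith)
  have hm1 : ε * (1 - c) ≤ 2 / 3 := by nlinarith
  have hu : ε * (1 - c) ^ 2 ≤ ε * (1 - 2 * c + q) := mul_le_mul_of_nonneg_left (by linarith) h0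
  have hv : 3 * (ε * (1 - c)) ^ 2 ≤ ε * (1 - c) ^ 2 := by
    nlinarith [mul_nonneg h0 (sq_nonneg (1 - c))]
  have hw : 0 ≤ (ε * (1 - c)) ^ 3 * (4 - ε * (1 - c)) := by
    apply mul_nonneg (by positivity); linarith
  have e1 : (1 - ε + ε * c) = 1 - ε * (1 - c) := by ring
  rw [e1]
  generalize ε * (1 - c) = m at *
  nlinarith

theorem cosContrast_le {θ σ ε : ℝ} {Q : Measure ℝ} [IsProbabilityMeasure Q]
    (h0 : 0 ≤ ε) (h1 : ε ≤ 1) (t a : ℝ) :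
    cosContrast (efron θ σ ε Q) t a ≤ exp (-(2 * σ ^ 2 * t ^ 2)) *
      ((1 - ε) * cos (2 * (t * (θ - a))) + ε) := by
  rw [cosContrast_efron h0 h1]
  have hb := (abs_le.1 (abs_cosMean_le_one Q (2 * t) a)).2
  have : 0 ≤ ((1 - ε) * cos (t * (θ - a)) + ε * cosMean Q t a) ^ 4 := by positivity
  gcongr
  nlinarith

theorem cosContrast_le_sin {θ σ ε : ℝ} {Q : Measure ℝ} [IsProbabilityMeasure Q]
    (h0 : 0 ≤ ε) (h1 : ε ≤ 1) (t a : ℝ) :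
    cosContrast (efron θ σ ε Q) t a ≤ exp (-(2 * σ ^ 2 * t ^ 2)) *
      (-sin (t * (θ - a)) ^ 4 + 10 * ε) := by
  rw [cosContrast_efron h0 h1]
  have hb := (abs_le.1 (abs_cosMean_le_one Q (2 * t) a)).2
  have hb' := abs_le.1 (abs_cosMean_le_one Q t a)
  have hc1 := cos_le_one (t * (θ - a))
  have hc2 := neg_one_le_cos (t * (θ - a))
  have hs := sin_sq_add_cos_sq (t * (θ - a))
  rw [cos_two_mul]
  generalize cosMean Q t a = α at *
  generalize cosMean Q (2 * t) a = β at *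
  generalize cos (t * (θ - a)) = c at *
  generalize sin (t * (θ - a)) = s at *
  have hs4 : s ^ 4 = (1 - c ^ 2) ^ 2 := by rw [← hs]; ring
  rw [hs4]
  set A := (1 - ε) * c + ε * α with hA
  have hA1 : |A - c| ≤ 2 * ε := by rw [abs_le]; constructor <;> nlinarith
  have hA2 : |A + c| ≤ 2 := by rw [abs_le]; constructor <;> nlinarith
  have hA3 : |A ^ 2 + c ^ 2| ≤ 2 := by
    have : |A| ≤ 1 := by rw [abs_le]; constructor <;> nlinarith
    have := (sq_le_one_iff_abs_le_one A).2 this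
    have := (sq_le_one_iff_abs_le_one c).2 (abs_le.2 ⟨hc2, hc1⟩)
    rw [abs_of_nonneg (by positivity)]; linarith
  have hA4 : |A ^ 4 - c ^ 4| ≤ 8 * ε := by
    rw [show A ^ 4 - c ^ 4 = (A - c) * (A + c) * (A ^ 2 + c ^ 2) by ring, abs_mul, abs_mul]
    calc _ ≤ 2 * ε * 2 * 2 := by gcongr
      _ = _ := by ring
  have := (abs_le.1 hA4).1
  gcongr
  nlinarith [sq_nonneg c]

/-! ### Empirical means -/

/-- Empirical mean of `g` over the coordinates in `S`. -/
noncomputable def empMean {n : ℕ} (S : Finset (Fin n)) (g : ℝ → ℝ) (x : Fin n → ℝ) : ℝ :=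
  (∑ i ∈ S, g (x i)) / S.card

theorem measurable_empMean {n : ℕ} (S : Finset (Fin n)) {g : ℝ → ℝ} (hg : Measurable g) :
    Measurable (empMean S g) := by
  unfold empMean
  fun_prop

/-- Chebyshev's inequality for empirical means of functions bounded by one. -/
theorem iid_empMean_deviation {n : ℕ} (P : Measure ℝ) [IsProbabilityMeasure P]
    {S : Finset (Fin n)} (hS : S.Nonempty) {g : ℝ → ℝ} (hg : Measurable g)
    (hb : ∀ x, |g x| ≤ 1) {η : ℝ} (hη : 0 < η) :
    iid n P {x | η ≤ |empMean S g x - ∫ y, g y ∂P|} ≤ ENNReal.ofReal (1 / (S.card * η ^ 2)) := by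
  have : IsProbabilityMeasure (iid n P) := by unfold iid; infer_instance
  have hcard : (0 : ℝ) < S.card := by exact_mod_cast hS.card_pos
  have hmeas : ∀ i, Measurable (fun x : Fin n → ℝ => g (x i)) := fun i =>
    hg.comp (measurable_pi_apply i)
  have hmem : ∀ i, MemLp (fun x : Fin n → ℝ => g (x i)) 2 (iid n P) := fun i =>
    memLp_of_bounded (a := -1) (b := 1) (ae_of_all _ fun x => abs_le.1 (hb _))
      (hmeas i).aestronglyMeasurable 2
  have hmp : ∀ i, MeasurePreserving (Function.eval i) (iid n P) P := fun i =>
    measurePreserving_eval (fun _ => P) i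
  have hint : ∀ i, ∫ x, g (x i) ∂(iid n P) = ∫ y, g y ∂P := fun i => by
    have h := integral_map (hmp i).measurable.aemeasurable (hg.aestronglyMeasurable (μ := (iid n P).map (Function.eval i)))
    rw [(hmp i).map_eq] at h
    exact h.symm
  have hvar : Var[∑ i ∈ S, fun x : Fin n → ℝ => g (x i); iid n P] ≤ S.card := by
    rw [IndepFun.variance_sum (fun i _ => hmem i) (fun i _ j _ hij =>
      (iIndepFun_pi (μ := fun _ : Fin n => P) (fun _ => hg.aemeasurable)).indepFun hij)]
    calc _ ≤ ∑ i ∈ S, (1 : ℝ) := Finset.sum_le_sum fun i _ => by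
            have := variance_le_sq_of_bounded (μ := iid n P) (a := -1) (b := 1)
              (ae_of_all _ fun x => abs_le.1 (hb (x i))) (hmeas i).aemeasurable
            norm_num at this
            exact this
      _ = _ := by simp
  have hcheb := meas_ge_le_variance_div_sq (memLp_finsetSum' S fun i _ => hmem i)
    (c := η * S.card) (by positivity)
  have hmean : ∫ x, (∑ i ∈ S, fun x : Fin n → ℝ => g (x i)) x ∂(iid n P)
      = S.card * ∫ y, g y ∂P := by
    simp only [Finset.sum_apply]
    rw [integral_finsetSum _ fun i _ => (hmem i).integrable (by norm_num)]
    simp [hint]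
  rw [hmean] at hcheb
  have hset : {x : Fin n → ℝ | η ≤ |empMean S g x - ∫ y, g y ∂P|}
      = {x | η * S.card ≤ |(∑ i ∈ S, fun x : Fin n → ℝ => g (x i)) x
        - S.card * ∫ y, g y ∂P|} := by
    ext x
    simp only [Set.mem_ofPred_eq, Finset.sum_apply, empMean]
    rw [show (∑ i ∈ S, g (x i)) / (S.card : ℝ) - ∫ y, g y ∂P
      = (∑ i ∈ S, g (x i) - S.card * ∫ y, g y ∂P) / S.card by field_simp, abs_div,
      abs_of_pos hcard, le_div_iff₀ hcard]
  rw [hset]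
  refine hcheb.trans (ENNReal.ofReal_le_ofReal ?_)
  rw [div_le_div_iff₀ (by positivity) (by positivity)]
  nlinarith [mul_le_mul_of_nonneg_right hvar (show 0 ≤ S.card * η ^ 2 by positivity)]
/-! ### Pilot scale and location -/

/-- More than half of the coordinates in `S` lie within `r` of `q`. -/
def Majority {n : ℕ} (S : Finset (Fin n)) (q r : ℝ) (x : Fin n → ℝ) : Prop :=
  ∃ T ∈ S.powerset, S.card < 2 * T.card ∧ ∀ i ∈ T, |x i - q| ≤ r

theorem Majority.mono {n : ℕ} {S : Finset (Fin n)} {q r q' r' : ℝ} {x : Fin n → ℝ}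
    (h : Majority S q r x) (hr : r + |q' - q| ≤ r') : Majority S q' r' x := by
  obtain ⟨T, hT, hc, h⟩ := h
  refine ⟨T, hT, hc, fun i hi => ?_⟩
  have := abs_sub_le (x i) q q'
  rw [abs_sub_comm q q'] at this
  linarith [h i hi]

theorem Majority.exists_mem_mem {n : ℕ} {S : Finset (Fin n)} {q r q' r' : ℝ} {x : Fin n → ℝ}
    (h : Majority S q r x) (h' : Majority S q' r' x) : |q' - q| ≤ r + r' := by
  obtain ⟨T, hT, hc, h⟩ := h
  obtain ⟨T', hT', hc', h'⟩ := h'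
  rw [Finset.mem_powerset] at hT hT'
  have : (T ∩ T').Nonempty := by
    rw [← Finset.card_pos]
    have h1 := Finset.card_union_add_card_inter T T'
    have h2 := Finset.card_le_card (Finset.union_subset hT hT')
    omega
  obtain ⟨i, hi⟩ := this
  rw [Finset.mem_inter] at hi
  have h1 := abs_sub_le q' (x i) q
  rw [abs_sub_comm q' (x i)] at h1
  linarith [h i hi.1, h' i hi.2]

theorem iid_not_majority {n : ℕ} {θ σ ε : ℝ} {Q : Measure ℝ} [IsProbabilityMeasure Q]
    (hσ : 0 < σ) (h0 : 0 ≤ ε) (h1 : ε ≤ 1 / 3) {S : Finset (Fin n)} (hS : S.Nonempty) :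
    iid n (efron θ σ ε Q) {x | ¬ Majority S θ (4 * σ) x} ≤ ENNReal.ofReal (64 / S.card) := by
  have hp := isProbabilityMeasure_efron (θ := θ) (σ := σ) (Q := Q) h0 (by linarith)
  have hms : MeasurableSet {x : ℝ | |x - θ| ≤ 4 * σ} :=
    measurableSet_le (by fun_prop) measurable_const
  set g : ℝ → ℝ := Set.indicator {x : ℝ | |x - θ| ≤ 4 * σ} 1 with hg
  have hb : ∀ x, |g x| ≤ 1 := fun x => by
    rw [hg]; by_cases hx : x ∈ {x : ℝ | |x - θ| ≤ 4 * σ} <;> simp [hx]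
  have h := iid_empMean_deviation (efron θ σ ε Q) hS
    ((measurable_one (α := ℝ) (β := ℝ)).indicator hms) hb (η := 1 / 8) (by norm_num)
  rw [integral_indicator_one hms] at h
  refine (measure_mono ?_).trans (h.trans (ENNReal.ofReal_le_ofReal (le_of_eq ?_)))
  · intro x hx
    simp only [Set.mem_ofPred_eq] at hx ⊢
    have hcard : (0 : ℝ) < S.card := by exact_mod_cast hS.card_pos
    have hmean := le_efron_Icc_center (θ := θ) (Q := Q) hσ h0 h1
    have hsum : empMean S g x ≤ 1 / 2 := by
      classical
      unfold empMean
      rw [div_le_iff₀ hcard]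
      have : ∑ i ∈ S, g (x i) = ((S.filter fun i => |x i - θ| ≤ 4 * σ).card : ℝ) := by
        rw [Finset.card_filter]
        push_cast
        refine Finset.sum_congr rfl fun i _ => ?_
        rw [hg]
        by_cases hx : |x i - θ| ≤ 4 * σ <;> simp [hx]
      rw [this]
      by_contra hlt
      apply hx
      refine ⟨_, Finset.mem_powerset.2 (Finset.filter_subset (fun i => |x i - θ| ≤ 4 * σ) S), ?_,
        fun i hi => (Finset.mem_filter.1 hi).2⟩
      have : (S.card : ℝ) < 2 * ((S.filter fun i => |x i - θ| ≤ 4 * σ).card : ℝ) := by linarith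
      exact_mod_cast this
    rw [abs_sub_comm]
    exact le_trans (by linarith) (le_abs_self _)
  · rw [show (S.card : ℝ) * (1 / 8) ^ 2 = S.card / 64 by ring, one_div_div]

theorem iid_exists_close_pair {n : ℕ} {θ σ ε : ℝ} {Q : Measure ℝ} [IsProbabilityMeasure Q]
    (hσ : 0 < σ) (h0 : 0 ≤ ε) (h1 : ε ≤ 1) (S : Finset (Fin n)) (c : ℝ) :
    iid n (efron θ σ ε Q) {x | ∃ p ∈ S.offDiag, |x p.1 - x p.2| ≤ c * σ}
      ≤ ENNReal.ofReal (S.card ^ 2 * c) := by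
  have hp := isProbabilityMeasure_efron (θ := θ) (σ := σ) (Q := Q) h0 h1
  set P := efron θ σ ε Q with hP
  have : IsProbabilityMeasure (iid n P) := by unfold iid; infer_instance
  have hpair : ∀ p ∈ S.offDiag, iid n P {x | |x p.1 - x p.2| ≤ c * σ} ≤ ENNReal.ofReal c := by
    intro p hpS
    have hne : p.1 ≠ p.2 := (Finset.mem_offDiag.1 hpS).2.2
    have hind : IndepFun (fun x : Fin n → ℝ => x p.1) (fun x => x p.2) (iid n P) :=
      (iIndepFun_pi (μ := fun _ : Fin n => P) (X := fun _ => id)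
        (fun _ => aemeasurable_id)).indepFun hne
    have hmap := (indepFun_iff_map_prod_eq_prod_map_map (measurable_pi_apply _).aemeasurable
      (measurable_pi_apply _).aemeasurable).1 hind
    have e : ∀ i, (iid n P).map (fun x : Fin n → ℝ => x i) = P := fun i =>
      (measurePreserving_eval (fun _ : Fin n => P) i).map_eq
    rw [e, e] at hmap
    have hms : MeasurableSet {z : ℝ × ℝ | |z.1 - z.2| ≤ c * σ} :=
      measurableSet_le (by fun_prop) measurable_const
    have h1 : iid n P {x | |x p.1 - x p.2| ≤ c * σ}
        = (P.prod P) {z : ℝ × ℝ | |z.1 - z.2| ≤ c * σ} := by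
      rw [← hmap, Measure.map_apply (by fun_prop) hms]
      rfl
    rw [h1, Measure.prod_apply hms]
    calc _ ≤ ∫⁻ _, ENNReal.ofReal c ∂P := by
          apply lintegral_mono
          intro y
          refine le_trans (measure_mono ?_) (efron_Icc_le (θ := θ) (Q := Q) hσ h0 ‹_› y c)
          intro z hz
          simp only [Set.mem_preimage, Set.mem_ofPred_eq, abs_le] at hz
          exact ⟨by linarith [hz.2], by linarith [hz.1]⟩
      _ = _ := by simp
  have hun : {x : Fin n → ℝ | ∃ p ∈ S.offDiag, |x p.1 - x p.2| ≤ c * σ}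
      = ⋃ p ∈ S.offDiag, {x | |x p.1 - x p.2| ≤ c * σ} := by
    ext x; simp
  rw [hun]
  calc _ ≤ ∑ p ∈ S.offDiag, iid n P {x | |x p.1 - x p.2| ≤ c * σ} :=
        measure_biUnion_finset_le _ _
    _ ≤ ∑ p ∈ S.offDiag, ENNReal.ofReal c := Finset.sum_le_sum hpair
    _ = S.offDiag.card * ENNReal.ofReal c := by simp
    _ ≤ ((S.card ^ 2 : ℕ) : ℝ≥0∞) * ENNReal.ofReal c := by
        gcongr
        rw [Finset.offDiag_card, sq]
        exact Nat.sub_le _ _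
    _ = _ := by
        rw [ENNReal.ofReal_mul (by positivity), ← ENNReal.ofReal_natCast]
        push_cast; rfl

/-- Smallest gap between two coordinates in `S`. -/
noncomputable def minGap {n : ℕ} (S : Finset (Fin n)) (x : Fin n → ℝ) : ℝ :=
  ⨅ p : {p // p ∈ S.offDiag}, |x p.1.1 - x p.1.2|

theorem measurable_minGap {n : ℕ} (S : Finset (Fin n)) : Measurable (minGap S) := by
  unfold minGap
  exact Measurable.iInf fun p => by fun_prop

theorem le_minGap {n : ℕ} {S : Finset (Fin n)} (hS : 2 ≤ S.card) {x : Fin n → ℝ} {c : ℝ}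
    (h : ¬ ∃ p ∈ S.offDiag, |x p.1 - x p.2| ≤ c) : c ≤ minGap S x := by
  obtain ⟨a, ha, b, hb, hab⟩ := Finset.one_lt_card.1 (show 1 < S.card by omega)
  have : Nonempty {p // p ∈ S.offDiag} := ⟨⟨(a, b), Finset.mem_offDiag.2 ⟨ha, hb, hab⟩⟩⟩
  push Not at h
  exact le_ciInf fun p => (h p.1 p.2).le

theorem minGap_le {n : ℕ} {S : Finset (Fin n)} (hS : 2 ≤ S.card) {x : Fin n → ℝ} {q r : ℝ}
    (h : Majority S q r x) : minGap S x ≤ 2 * r := by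
  obtain ⟨T, hT, hc, h⟩ := h
  obtain ⟨a, ha, b, hb, hab⟩ := Finset.one_lt_card.1 (show 1 < T.card by omega)
  rw [Finset.mem_powerset] at hT
  refine (ciInf_le ⟨0, ?_⟩ (⟨(a, b), Finset.mem_offDiag.2 ⟨hT ha, hT hb, hab⟩⟩ :
    {p // p ∈ S.offDiag})).trans ?_
  · rintro _ ⟨p, rfl⟩
    exact abs_nonneg _
  · have := abs_sub_le (x a) q (x b)
    rw [abs_sub_comm q (x b)] at this
    linarith [h a ha, h b hb]

/-! ### The empirical statistic -/

/-- Empirical counterpart of `cosContrast`. -/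
noncomputable def empContrast {n : ℕ} (S : Finset (Fin n)) (t a : ℝ) (x : Fin n → ℝ) : ℝ :=
  empMean S (fun y => cos (2 * t * (y - a))) x - empMean S (fun y => cos (t * (y - a))) x ^ 4

theorem measurable_empContrast {n : ℕ} (S : Finset (Fin n)) (t a : ℝ) :
    Measurable (empContrast S t a) :=
  (measurable_empMean S (by fun_prop)).sub ((measurable_empMean S (by fun_prop)).pow_const 4)

theorem abs_empMean_le_one {n : ℕ} (S : Finset (Fin n)) {g : ℝ → ℝ} (hb : ∀ y, |g y| ≤ 1)
    (x : Fin n → ℝ) : |empMean S g x| ≤ 1 := by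
  unfold empMean
  rw [abs_div, Nat.abs_cast]
  refine div_le_one_of_le₀ ((Finset.abs_sum_le_sum_abs _ _).trans ?_) (Nat.cast_nonneg _)
  calc _ ≤ ∑ i ∈ S, (1 : ℝ) := Finset.sum_le_sum fun i _ => hb _
    _ = _ := by simp

theorem abs_empMean_sub_le {n : ℕ} {S : Finset (Fin n)} (hS : S.Nonempty) {g h : ℝ → ℝ} {L : ℝ}
    (hb : ∀ y, |g y - h y| ≤ L) (x : Fin n → ℝ) : |empMean S g x - empMean S h x| ≤ L := by
  have hcard : (0 : ℝ) < S.card := by exact_mod_cast hS.card_pos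
  unfold empMean
  rw [← sub_div, ← Finset.sum_sub_distrib, abs_div, Nat.abs_cast, div_le_iff₀ hcard]
  refine (Finset.abs_sum_le_sum_abs _ _).trans ?_
  calc _ ≤ ∑ i ∈ S, L := Finset.sum_le_sum fun i _ => hb _
    _ = _ := by simp [mul_comm]

theorem abs_pow_four_sub_le {a b : ℝ} (ha : |a| ≤ 1) (hb : |b| ≤ 1) :
    |a ^ 4 - b ^ 4| ≤ 4 * |a - b| := by
  have h1 : |a + b| ≤ 2 := (abs_add_le a b).trans (by linarith)
  have h2 : |a ^ 2 + b ^ 2| ≤ 2 := by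
    rw [abs_of_nonneg (by positivity)]
    linarith [(sq_le_one_iff_abs_le_one a).2 ha, (sq_le_one_iff_abs_le_one b).2 hb]
  rw [show a ^ 4 - b ^ 4 = (a - b) * (a + b) * (a ^ 2 + b ^ 2) by ring, abs_mul, abs_mul]
  calc _ ≤ |a - b| * 2 * 2 := by gcongr
    _ = _ := by ring

theorem abs_empContrast_sub_le {n : ℕ} {S : Finset (Fin n)} (hS : S.Nonempty) {t : ℝ}
    (ht : 0 ≤ t) (a b : ℝ) (x : Fin n → ℝ) :
    |empContrast S t a x - empContrast S t b x| ≤ 6 * t * |a - b| := by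
  have hl : ∀ s : ℝ, 0 ≤ s → |empMean S (fun y => cos (s * (y - a))) x
      - empMean S (fun y => cos (s * (y - b))) x| ≤ s * |a - b| := fun s hs =>
    abs_empMean_sub_le hS (fun y => (Real.abs_cos_sub_cos_le _ _).trans (by
      rw [← mul_sub, abs_mul, abs_of_nonneg hs, abs_sub_comm a b]
      ring_nf; rfl)) x
  have h1 := hl (2 * t) (by positivity)
  have h2 := hl t ht
  have hb : ∀ c, |empMean S (fun y => cos (t * (y - c))) x| ≤ 1 := fun c =>
    abs_empMean_le_one S (fun y => abs_cos_le_one _) x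
  have h3 := abs_pow_four_sub_le (hb a) (hb b)
  unfold empContrast
  rw [abs_le] at *
  constructor <;> linarith [h1.1, h1.2, h3.1, h3.2, abs_le.2 h2]

/-- The empirical characteristic function is `η`-accurate at frequency `t`. -/
def CharClose {n : ℕ} (P : Measure ℝ) (S : Finset (Fin n)) (t η : ℝ) (x : Fin n → ℝ) : Prop :=
  |empMean S (fun y => cos (t * y)) x - ∫ y, cos (t * y) ∂P| < η ∧
    |empMean S (fun y => sin (t * y)) x - ∫ y, sin (t * y) ∂P| < η

theorem iid_not_charClose {n : ℕ} (P : Measure ℝ) [IsProbabilityMeasure P]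
    {S : Finset (Fin n)} (hS : S.Nonempty) (t : ℝ) {η : ℝ} (hη : 0 < η) :
    iid n P {x | ¬ CharClose P S t η x} ≤ ENNReal.ofReal (2 / (S.card * η ^ 2)) := by
  have h1 := iid_empMean_deviation P hS (g := fun y => cos (t * y)) (by fun_prop)
    (fun x => abs_cos_le_one _) hη
  have h2 := iid_empMean_deviation P hS (g := fun y => sin (t * y)) (by fun_prop)
    (fun x => abs_sin_le_one _) hη
  have hset : {x : Fin n → ℝ | ¬ CharClose P S t η x}
      ⊆ {x | η ≤ |empMean S (fun y => cos (t * y)) x - ∫ y, cos (t * y) ∂P|}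
        ∪ {x | η ≤ |empMean S (fun y => sin (t * y)) x - ∫ y, sin (t * y) ∂P|} := by
    intro x hx
    simp only [CharClose, Set.mem_ofPred_eq, not_and_or, not_lt] at hx
    exact hx
  refine (measure_mono hset).trans ((measure_union_le _ _).trans ((add_le_add h1 h2).trans ?_))
  rw [← ENNReal.ofReal_add (by positivity) (by positivity), ← two_mul, mul_one_div]

theorem CharClose.abs_empMean_sub_cosMean_le {n : ℕ} {P : Measure ℝ} [IsProbabilityMeasure P]
    {S : Finset (Fin n)} {t η : ℝ} {x : Fin n → ℝ} (h : CharClose P S t η x) (a : ℝ) :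
    |empMean S (fun y => cos (t * (y - a))) x - cosMean P t a| ≤ 2 * η := by
  have e1 : empMean S (fun y => cos (t * (y - a))) x
      = cos (t * a) * empMean S (fun y => cos (t * y)) x
        + sin (t * a) * empMean S (fun y => sin (t * y)) x := by
    unfold empMean
    rw [mul_div_assoc', mul_div_assoc', ← add_div, Finset.mul_sum, Finset.mul_sum,
      ← Finset.sum_add_distrib]
    congr 1
    refine Finset.sum_congr rfl fun i _ => ?_
    dsimp only
    rw [mul_sub, cos_sub]; ring
  have hci : Integrable (fun y => cos (t * y)) P :=
    (integrable_const (1 : ℝ)).mono' (by fun_prop) (ae_of_all _ fun x => abs_cos_le_one _)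
  have hsi : Integrable (fun y => sin (t * y)) P :=
    (integrable_const (1 : ℝ)).mono' (by fun_prop) (ae_of_all _ fun x => abs_sin_le_one _)
  have e2 : cosMean P t a
      = cos (t * a) * (∫ y, cos (t * y) ∂P) + sin (t * a) * ∫ y, sin (t * y) ∂P := by
    unfold cosMean
    rw [← integral_const_mul, ← integral_const_mul,
      ← integral_add (hci.const_mul _) (hsi.const_mul _)]
    congr 1; ext y
    rw [mul_sub, cos_sub]; ring
  rw [e1, e2]
  obtain ⟨h1, h2⟩ := h
  generalize empMean S (fun y => cos (t * y)) x = A at *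
  generalize empMean S (fun y => sin (t * y)) x = B at *
  generalize ∫ y, cos (t * y) ∂P = A' at *
  generalize ∫ y, sin (t * y) ∂P = B' at *
  rw [show cos (t * a) * A + sin (t * a) * B - (cos (t * a) * A' + sin (t * a) * B')
    = cos (t * a) * (A - A') + sin (t * a) * (B - B') by ring]
  refine (abs_add_le _ _).trans ?_
  rw [abs_mul, abs_mul]
  nlinarith [abs_cos_le_one (t * a), abs_sin_le_one (t * a), abs_nonneg (A - A'),
    abs_nonneg (B - B')]

theorem abs_empContrast_sub_cosContrast_le {n : ℕ} {P : Measure ℝ} [IsProbabilityMeasure P]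
    {S : Finset (Fin n)} {t η : ℝ} {x : Fin n → ℝ} (h : CharClose P S t η x)
    (h' : CharClose P S (2 * t) η x) (a : ℝ) :
    |empContrast S t a x - cosContrast P t a| ≤ 10 * η := by
  have h1 := h.abs_empMean_sub_cosMean_le a
  have h2 := h'.abs_empMean_sub_cosMean_le a
  have h3 := abs_pow_four_sub_le (abs_empMean_le_one S (g := fun y => cos (t * (y - a)))
    (fun y => abs_cos_le_one _) x) (abs_cosMean_le_one P t a)
  unfold empContrast cosContrast
  rw [abs_le] at *
  constructor <;> linarith [h1.1, h1.2, h2.1, h2.2, h3.1, h3.2,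
    abs_le.2 h1]

/-- Simultaneous accuracy along the geometric grid, with a tolerance proportional to frequency. -/
def GridClose {n : ℕ} (P : Measure ℝ) (S : Finset (Fin n)) (c τ : ℝ) (x : Fin n → ℝ) : Prop :=
  ∀ k : ℤ, c ≤ (3 / 2 : ℝ) ^ k → CharClose P S ((3 / 2) ^ k) (τ * (3 / 2) ^ k) x ∧
    CharClose P S (2 * (3 / 2) ^ k) (τ * (3 / 2) ^ k) x

theorem iid_not_gridClose {n : ℕ} (P : Measure ℝ) [IsProbabilityMeasure P]
    {S : Finset (Fin n)} (hS : S.Nonempty) {c τ : ℝ} (hc : 0 < c) (hτ : 0 < τ) :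
    iid n P {x | ¬ GridClose P S c τ x} ≤ ENNReal.ofReal (8 / (S.card * τ ^ 2 * c ^ 2)) := by
  have hcard : (0 : ℝ) < S.card := by exact_mod_cast hS.card_pos
  obtain ⟨k₀, hk₀, hk₁⟩ := exists_mem_Ioc_zpow hc (show (1 : ℝ) < 3 / 2 by norm_num)
  set B : ℕ → Set (Fin n → ℝ) := fun j =>
    {x | ¬ CharClose P S ((3 / 2) ^ (k₀ + 1 + j)) (τ * (3 / 2) ^ (k₀ + 1 + j)) x} ∪
    {x | ¬ CharClose P S (2 * (3 / 2) ^ (k₀ + 1 + j)) (τ * (3 / 2) ^ (k₀ + 1 + j)) x} with hB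
  have hsub : {x | ¬ GridClose P S c τ x} ⊆ ⋃ j, B j := by
    intro x hx
    simp only [GridClose, Set.mem_ofPred_eq, not_forall] at hx
    obtain ⟨k, hk, hx⟩ := hx
    have hlt : k₀ < k := by
      have : (3 / 2 : ℝ) ^ k₀ < (3 / 2) ^ k := hk₀.trans_le hk
      exact (zpow_lt_zpow_iff_right₀ (by norm_num)).1 this
    obtain ⟨j, hj⟩ := Int.eq_ofNat_of_zero_le (show 0 ≤ k - (k₀ + 1) by omega)
    have hk' : k = k₀ + 1 + (j : ℕ) := by omega
    subst hk'
    rw [Set.mem_iUnion]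
    exact ⟨j, not_and_or.1 hx⟩
  have hBj : ∀ j, iid n P (B j)
      ≤ ENNReal.ofReal (4 / (S.card * τ ^ 2 * c ^ 2) * (4 / 9) ^ j) := by
    intro j
    have hpos : (0 : ℝ) < (3 / 2) ^ (k₀ + 1 + (j : ℤ)) := by positivity
    have hge : c * (3 / 2) ^ j ≤ (3 / 2 : ℝ) ^ (k₀ + 1 + (j : ℤ)) := by
      rw [zpow_add₀ (by norm_num) (k₀ + 1), zpow_natCast]
      gcongr
    have h1 := iid_not_charClose P hS ((3 / 2) ^ (k₀ + 1 + (j : ℤ)))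
      (η := τ * (3 / 2) ^ (k₀ + 1 + (j : ℤ))) (by positivity)
    have h2 := iid_not_charClose P hS (2 * (3 / 2) ^ (k₀ + 1 + (j : ℤ)))
      (η := τ * (3 / 2) ^ (k₀ + 1 + (j : ℤ))) (by positivity)
    refine (measure_union_le _ _).trans ((add_le_add h1 h2).trans ?_)
    rw [← ENNReal.ofReal_add (by positivity) (by positivity)]
    apply ENNReal.ofReal_le_ofReal
    generalize (3 / 2 : ℝ) ^ (k₀ + 1 + (j : ℤ)) = T at *
    calc 2 / (S.card * (τ * T) ^ 2) + 2 / (S.card * (τ * T) ^ 2)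
        = 4 / (S.card * (τ * T) ^ 2) := by ring
      _ ≤ 4 / (S.card * (τ * (c * (3 / 2) ^ j)) ^ 2) := by gcongr
      _ = _ := by
        rw [show (4 / 9 : ℝ) ^ j = 1 / ((3 / 2) ^ j) ^ 2 by
          rw [← pow_mul, mul_comm, pow_mul, one_div, ← inv_pow]; norm_num]
        field_simp
  have hgeo : HasSum (fun j : ℕ => 4 / (S.card * τ ^ 2 * c ^ 2) * (4 / 9 : ℝ) ^ j)
      (4 / (S.card * τ ^ 2 * c ^ 2) * (1 - 4 / 9)⁻¹) :=
    (hasSum_geometric_of_lt_one (by norm_num) (by norm_num)).mul_left _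
  calc iid n P {x | ¬ GridClose P S c τ x} ≤ ∑' j, iid n P (B j) :=
        (measure_mono hsub).trans (measure_iUnion_le _)
    _ ≤ ∑' j, ENNReal.ofReal (4 / (S.card * τ ^ 2 * c ^ 2) * (4 / 9) ^ j) :=
        ENNReal.tsum_le_tsum hBj
    _ = ENNReal.ofReal (4 / (S.card * τ ^ 2 * c ^ 2) * (1 - 4 / 9)⁻¹) := by
        rw [← ENNReal.ofReal_tsum_of_nonneg (fun j => by positivity) hgeo.summable, hgeo.tsum_eq]
    _ ≤ _ := by
        apply ENNReal.ofReal_le_ofReal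
        rw [div_mul_eq_mul_div]
        gcongr
        norm_num

/-! ### Separation of wrong centers -/

theorem exp_max_log_div_four_le {y ε : ℝ} (hy : 1 ≤ y) (h0 : 0 ≤ ε) (h1 : ε ≤ 1) :
    exp (max 1 (log (exp 1 * y * ε ^ 2)) / 4) ≤ 2 * (2 + √y * ε) ∧
      exp (max 1 (log (exp 1 * y * ε ^ 2)) / 4) ≤ 2 * y ^ ((1 : ℝ) / 4) := by
  set w := y * ε ^ 2 with hw
  have hw0 : 0 ≤ w := by positivity
  have he : exp 1 < 3 := Real.exp_one_lt_d9.trans (by norm_num)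
  have hz : exp (max 1 (log (exp 1 * y * ε ^ 2)) / 4) ^ 4 ≤ 3 * max 1 w := by
    rw [← Real.exp_nat_mul, show ((4 : ℕ) : ℝ) * (max 1 (log (exp 1 * y * ε ^ 2)) / 4)
      = max 1 (log (exp 1 * y * ε ^ 2)) by push_cast; ring, mul_assoc, ← hw]
    rcases le_total (log (exp 1 * w)) 1 with h | h
    · rw [max_eq_left h]
      linarith [le_max_left 1 w]
    · rw [max_eq_right h, Real.exp_log]
      · nlinarith [le_max_right 1 w, exp_pos 1, le_max_left 1 w]
      · rcases hw0.eq_or_lt with h' | h'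
        · rw [← h'] at h; norm_num at h
        · positivity
  constructor
  · refine le_of_pow_le_pow_left₀ (n := 4) (by norm_num) (by positivity) (hz.trans ?_)
    have hu : w = (√y * ε) ^ 2 := by rw [mul_pow, Real.sq_sqrt (by linarith)]
    have hu0 : 0 ≤ √y * ε := by positivity
    rw [hu]
    generalize √y * ε = u at *
    have : max 1 (u ^ 2) ≤ (2 + u) ^ 2 := max_le (by nlinarith) (by nlinarith)
    have h4 : 1 ≤ (2 + u) ^ 2 := by nlinarith
    rw [mul_pow, show (2 + u) ^ 4 = (2 + u) ^ 2 * (2 + u) ^ 2 by ring]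
    nlinarith
  · refine le_of_pow_le_pow_left₀ (n := 4) (by norm_num) (by positivity) (hz.trans ?_)
    rw [mul_pow, ← Real.rpow_natCast (y ^ ((1 : ℝ) / 4)), ← Real.rpow_mul (by linarith)]
    norm_num
    have : max 1 w ≤ y := max_le hy (by
      rw [hw]
      have : ε ^ 2 ≤ 1 := pow_le_one₀ h0 h1
      nlinarith)
    linarith

theorem mul_exp_le_exp_div_four {x L : ℝ} (hx : 12 * x ^ 2 ≤ L) :
    x * exp (2 * x ^ 2) ≤ exp (L / 4) := by
  have h1 : x ≤ exp (x ^ 2) := by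
    nlinarith [Real.add_one_le_exp (x ^ 2), sq_nonneg (x - 1)]
  calc _ ≤ exp (x ^ 2) * exp (2 * x ^ 2) := by gcongr
    _ = exp (3 * x ^ 2) := by rw [← Real.exp_add]; ring_nf
    _ ≤ _ := Real.exp_le_exp.2 (by linarith)

theorem neg_exp_bound {b v X x L y A : ℝ} (hx : 12 * x ^ 2 ≤ L) (hA : 0 ≤ A)
    (hlow : -(A * x / √y) ≤ v) (hup : v ≤ exp (-(2 * x ^ 2)) * X) (hb : exp (L / 4) ≤ b) :
    -(A * b / √y) ≤ X := by
  have hpos := exp_pos (2 * x ^ 2)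
  have h1 : -(A * x / √y) * exp (2 * x ^ 2) ≤ X := by
    calc _ ≤ exp (-(2 * x ^ 2)) * X * exp (2 * x ^ 2) :=
          mul_le_mul_of_nonneg_right (hlow.trans hup) hpos.le
      _ = X := by rw [mul_right_comm, ← Real.exp_add]; simp
  have h2 : A * (x * exp (2 * x ^ 2)) / √y ≤ A * b / √y := by
    have := (mul_exp_le_exp_div_four hx).trans hb
    gcongr
  have h3 : -(A * x / √y) * exp (2 * x ^ 2) = -(A * (x * exp (2 * x ^ 2)) / √y) := by ring
  linarith

theorem le_of_quartic_bound {u v s A a b : ℝ} (hA : 0 ≤ A) (ha : 0 ≤ a) (hb : 0 ≤ b)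
    (hs : (u / 2) ^ 4 ≤ s) (hv : v = 4 * A * a ^ 4 + 2 * A * b ^ 4)
    (h : -v ≤ -s + 10 * b ^ 4) : u ≤ (161 + 64 * A) * (a + b) := by
  have ha4 := pow_nonneg ha 4
  have hb4 := pow_nonneg hb 4
  have hmain : u ^ 4 ≤ (161 + 64 * A) * (a ^ 4 + b ^ 4) := by
    have h1 : (u / 2) ^ 4 = u ^ 4 / 16 := by ring
    have h2 := mul_nonneg hA hb4
    have h3 : (161 + 64 * A) * (a ^ 4 + b ^ 4)
      = 161 * a ^ 4 + 161 * b ^ 4 + 64 * (A * a ^ 4) + 64 * (A * b ^ 4) := by ring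
    have h4 : v = 4 * (A * a ^ 4) + 2 * (A * b ^ 4) := by rw [hv]; ring
    linarith
  refine le_of_pow_le_pow_left₀ (n := 4) (by norm_num) (by positivity) (hmain.trans ?_)
  rw [mul_pow]
  have hB : 161 + 64 * A ≤ (161 + 64 * A) ^ 4 := by
    calc 161 + 64 * A = (161 + 64 * A) ^ 1 := (pow_one _).symm
      _ ≤ _ := pow_le_pow_right₀ (by linarith) (by norm_num)
  gcongr
  exact pow_add_pow_le ha hb (by norm_num)

/-- If the phase is small at the largest informative frequency, that frequency separates. -/
theorem abs_sub_le_of_cosContrast_ge_of_small {θ σ ε q y A κ L : ℝ} {Q : Measure ℝ}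
    [IsProbabilityMeasure Q] (hσ : 0 < σ) (h0 : 0 ≤ ε) (h1 : ε ≤ 1) (hA : 0 ≤ A)
    (hκ : κ ≤ 1 / 8) (hy : 0 < y) (hL1 : 1 ≤ L) (hE : exp (L / 4) ≤ 2 * (2 + √y * ε))
    (h : ∀ k : ℤ, κ ≤ (3 / 2 : ℝ) ^ k * σ →
      -(A * ((3 / 2 : ℝ) ^ k * σ) / √y) ≤ cosContrast (efron θ σ ε Q) ((3 / 2) ^ k) q)
    (hsmall : 3 * √L / 8 * |θ - q| < π * σ) :
    |θ - q| ≤ 8 * (161 + 64 * A) * σ * (y ^ (-(1 / 8 : ℝ)) + ε ^ ((1 : ℝ) / 4) / √L) := by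
  have hsL1 : 1 ≤ √L := Real.one_le_sqrt.2 hL1
  have hsL : √L ^ 2 = L := Real.sq_sqrt (by linarith)
  have hsy : 0 < √y := Real.sqrt_pos.2 hy
  have hr0 := abs_nonneg (θ - q)
  have hsin : ∀ s, sin (s * (θ - q)) ^ 4 = sin (s * |θ - q|) ^ 4 := fun s => by
    rcases abs_cases (θ - q) with ⟨he, _⟩ | ⟨he, _⟩ <;> rw [he]
    rw [mul_neg, sin_neg]; ring
  generalize |θ - q| = r at *
  obtain ⟨k, hk1, hk2⟩ := exists_mem_Ioc_zpow (show 0 < √L / (8 * σ) by positivity)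
    (show (1 : ℝ) < 3 / 2 by norm_num)
  have hk3 : (3 / 2 : ℝ) ^ (k + 1) ≤ 3 / 2 * (√L / (8 * σ)) := by
    rw [zpow_add_one₀ (by norm_num)]; linarith
  have hlow := h (k + 1)
  have ht : 0 < (3 / 2 : ℝ) ^ (k + 1) := by positivity
  generalize (3 / 2 : ℝ) ^ (k + 1) = t at *
  have hx1 : √L / 8 ≤ t * σ := by
    rw [div_le_iff₀ (by positivity)] at hk2; linarith
  have hx2 : t * σ ≤ 3 / 2 * (√L / 8) := by
    calc t * σ ≤ 3 / 2 * (√L / (8 * σ)) * σ := by gcongr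
      _ = _ := by field_simp
  have hup := cosContrast_le_sin (θ := θ) (σ := σ) (Q := Q) h0 h1 t q
  rw [hsin t, show 2 * σ ^ 2 * t ^ 2 = 2 * (t * σ) ^ 2 by ring] at hup
  have hxx : 12 * (t * σ) ^ 2 ≤ L := by
    have := pow_le_pow_left₀ (by positivity) hx2 2
    rw [show (3 / 2 * (√L / 8)) ^ 2 = 9 / 256 * √L ^ 2 by ring, hsL] at this
    linarith
  have hb := neg_exp_bound hxx hA (hlow (by linarith)) hup hE
  have htr : t * r ≤ π / 2 := by
    refine le_of_mul_le_mul_right ?_ hσ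
    have := mul_le_mul_of_nonneg_right hx2 hr0
    linarith
  have hsinlow : t * r / 2 ≤ sin (t * r) := by
    refine le_trans ?_ (Real.mul_le_sin (by positivity) htr)
    have : 1 / 2 ≤ 2 / π := by
      rw [div_le_div_iff₀ two_pos pi_pos]; linarith [Real.pi_lt_d2]
    calc t * r / 2 = 1 / 2 * (t * r) := by ring
      _ ≤ _ := by gcongr
  have hs4 : (t * r / 2) ^ 4 ≤ sin (t * r) ^ 4 := by gcongr
  set a := y ^ (-(1 / 8 : ℝ)) with ha
  have ha4 : a ^ 4 = 1 / √y := by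
    rw [ha, ← Real.rpow_natCast, ← Real.rpow_mul hy.le, Real.sqrt_eq_rpow, one_div (y ^ _),
      ← Real.rpow_neg hy.le]
    norm_num
  set b := ε ^ ((1 : ℝ) / 4) with hbdef
  have hb4 : b ^ 4 = ε := by
    rw [hbdef, ← Real.rpow_natCast, ← Real.rpow_mul h0]; norm_num
  have ha0 : 0 ≤ a := by positivity
  have hb0 : 0 ≤ b := by positivity
  have hv : A * (2 * (2 + √y * ε)) / √y = 4 * A * a ^ 4 + 2 * A * b ^ 4 := by
    rw [ha4, hb4]; field_simp; ring
  have htrle := le_of_quartic_bound hA ha0 hb0 hs4 hv (by rw [hb4]; exact hb)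
  have hfin : √L * r ≤ 8 * (161 + 64 * A) * σ * (a + b) := by
    calc √L * r = 8 * (√L / 8) * r := by ring
      _ ≤ 8 * (t * σ) * r := by gcongr
      _ = 8 * σ * (t * r) := by ring
      _ ≤ 8 * σ * ((161 + 64 * A) * (a + b)) := by gcongr
      _ = _ := by ring
  have hrle : r ≤ 8 * (161 + 64 * A) * σ * (a + b) / √L := by
    rw [le_div_iff₀ (by linarith)]; linarith
  refine hrle.trans ?_
  rw [mul_div_assoc, add_div]
  gcongr
  exact div_le_self ha0 hsL1

/-- If the phase at the largest informative frequency is not small, a lower frequency turns it by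
about half a period and rejects. -/
theorem not_cosContrast_ge_of_large {θ σ ε q y A κ R L : ℝ} {Q : Measure ℝ}
    [IsProbabilityMeasure Q] (hσ : 0 < σ) (h0 : 0 ≤ ε) (h1 : ε ≤ 1 / 3) (hA : 0 ≤ A)
    (hRκ : κ * R ≤ 1) (hq : |θ - q| ≤ R * σ) (hy0 : 0 < y)
    (hy : 10 * A < y ^ ((1 : ℝ) / 4)) (hL1 : 1 ≤ L) (hE : exp (L / 4) ≤ 2 * y ^ ((1 : ℝ) / 4))
    (h : ∀ k : ℤ, κ ≤ (3 / 2 : ℝ) ^ k * σ →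
      -(A * ((3 / 2 : ℝ) ^ k * σ) / √y) ≤ cosContrast (efron θ σ ε Q) ((3 / 2) ^ k) q)
    (hlarge : π * σ ≤ 3 * √L / 8 * |θ - q|) : False := by
  have hsL : √L ^ 2 = L := Real.sq_sqrt (by linarith)
  have hsy : 0 < √y := Real.sqrt_pos.2 hy0
  have hr0 : 0 < |θ - q| := by
    refine (abs_nonneg _).lt_of_ne fun h0 => ?_
    rw [← h0, mul_zero] at hlarge
    exact absurd (mul_pos pi_pos hσ) (not_lt.2 hlarge)
  have hcos : ∀ s, 0 < s → cos (2 * (s * (θ - q))) = cos (2 * (s * |θ - q|)) := fun s hs => by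
    rw [← cos_abs, abs_mul, abs_mul, abs_of_pos hs, abs_two]
  generalize |θ - q| = r at *
  have hpi3 := Real.pi_gt_three
  have hpi3' := Real.pi_gt_d2
  have hpi4 := Real.pi_lt_d2
  obtain ⟨k, hk1, hk2⟩ := exists_mem_Ioc_zpow (show 0 < 3 / 5 * π / r by positivity)
    (show (1 : ℝ) < 3 / 2 by norm_num)
  rw [zpow_add_one₀ (by norm_num)] at hk2
  have hlow := h k
  have ht : 0 < (3 / 2 : ℝ) ^ k := by positivity
  generalize (3 / 2 : ℝ) ^ k = t at *
  rw [lt_div_iff₀ hr0] at hk1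
  rw [div_le_iff₀ hr0] at hk2
  have hup := cosContrast_le (θ := θ) (σ := σ) (Q := Q) h0 (by linarith) t q
  rw [hcos t ht, show 2 * σ ^ 2 * t ^ 2 = 2 * (t * σ) ^ 2 by ring] at hup
  have hxle : t * σ ≤ 9 / 40 * √L := by
    refine le_of_mul_le_mul_left ?_ pi_pos
    calc π * (t * σ) = t * (π * σ) := by ring
      _ ≤ t * (3 * √L / 8 * r) := by gcongr
      _ = (t * r) * (3 * √L / 8) := by ring
      _ ≤ (3 / 5 * π) * (3 * √L / 8) := by gcongr
      _ = _ := by ring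
  have hxx : 12 * (t * σ) ^ 2 ≤ L := by
    have : (t * σ) ^ 2 ≤ (9 / 40 * √L) ^ 2 := pow_le_pow_left₀ (by positivity) hxle 2
    rw [mul_pow (9 / 40), hsL] at this
    linarith
  have hκx : κ ≤ t * σ := by
    refine le_of_mul_le_mul_right ?_ hr0
    rcases le_total κ 0 with hk | hk
    · exact (mul_nonpos_of_nonpos_of_nonneg hk hr0.le).trans (by positivity)
    · calc κ * r ≤ κ * (R * σ) := by gcongr
        _ = κ * R * σ := by ring
        _ ≤ 1 * σ := by gcongr
        _ ≤ (t * r) * σ := by gcongr; linarith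
        _ = _ := by ring
  have hb := neg_exp_bound hxx hA (hlow hκx) hup hE
  have hcosle : cos (2 * (t * r)) ≤ -(4 / 5) := by
    rw [cos_two_mul]
    have h4 : |cos (t * r)| ≤ 315 / 1000 := by
      rw [← sin_pi_div_two_sub]
      refine Real.abs_sin_le_abs.trans ?_
      rw [abs_le]; constructor <;> linarith
    have := sq_le_sq' (abs_le.1 h4).1 (abs_le.1 h4).2
    linarith
  have hD : (1 - ε) * cos (2 * (t * r)) + ε ≤ -(1 / 5) := by
    have := mul_le_mul_of_nonneg_left hcosle (show 0 ≤ 1 - ε by linarith)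
    linarith
  have hlt : A * (2 * y ^ ((1 : ℝ) / 4)) / √y < 1 / 5 := by
    have hsq : √y = y ^ ((1 : ℝ) / 4) * y ^ ((1 : ℝ) / 4) := by
      rw [← Real.rpow_add hy0, Real.sqrt_eq_rpow]; norm_num
    have hp : 0 < y ^ ((1 : ℝ) / 4) := by positivity
    rw [div_lt_iff₀ hsy, hsq]
    have := mul_lt_mul_of_pos_right hy hp
    linarith
  linarith

/-- If the contrast at `q` is not significantly negative along the frequency grid, then `q` is
close to the center. -/
theorem abs_sub_le_of_cosContrast_ge {θ σ ε q y A κ R : ℝ} {Q : Measure ℝ}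
    [IsProbabilityMeasure Q] (hσ : 0 < σ) (h0 : 0 ≤ ε) (h1 : ε ≤ 1 / 3) (hA : 0 ≤ A)
    (hκ : κ ≤ 1 / 8) (hRκ : κ * R ≤ 1) (hq : |θ - q| ≤ R * σ) (hy1 : 1 ≤ y)
    (hy : 10 * A < y ^ ((1 : ℝ) / 4))
    (h : ∀ k : ℤ, κ ≤ (3 / 2 : ℝ) ^ k * σ →
      -(A * ((3 / 2 : ℝ) ^ k * σ) / √y) ≤ cosContrast (efron θ σ ε Q) ((3 / 2) ^ k) q) :
    |θ - q| ≤ 8 * (161 + 64 * A) * σ * (y ^ (-(1 / 8 : ℝ)) +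
      ε ^ ((1 : ℝ) / 4) / √(max 1 (log (exp 1 * y * ε ^ 2)))) := by
  obtain ⟨hE1, hE2⟩ := exp_max_log_div_four_le hy1 h0 (by linarith : ε ≤ 1)
  have hL1 : 1 ≤ max 1 (log (exp 1 * y * ε ^ 2)) := le_max_left _ _
  generalize max 1 (log (exp 1 * y * ε ^ 2)) = L at *
  rcases lt_or_ge (3 * √L / 8 * |θ - q|) (π * σ) with hsmall | hlarge
  · exact abs_sub_le_of_cosContrast_ge_of_small hσ h0 (by linarith) hA hκ (by linarith) hL1 hE1 h
      hsmall
  · exact (not_cosContrast_ge_of_large hσ h0 h1 hA hRκ hq (by linarith) hy hL1 hE2 h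
      hlarge).elim

/-! ### Measurable hulls of random sets of rationals -/

theorem exists_measurable_hull {Ω : Type*} [MeasurableSpace Ω] (pass : ℚ → Ω → Prop)
    (hpass : ∀ q, MeasurableSet {x | pass q x}) :
    ∃ l u : Ω → ℝ, Measurable l ∧ Measurable u ∧ (∀ x, l x ≤ u x) ∧
      ∀ (x : Ω) (θ ρ η : ℝ), 0 < η → (∀ q : ℚ, pass q x → |θ - (q : ℝ)| ≤ ρ) →
        (∀ q : ℚ, |(q : ℝ) - θ| ≤ η → pass q x) → l x ≤ θ ∧ θ ≤ u x ∧ u x - l x ≤ 2 * ρ := by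
  classical
  set lo : Ω → EReal := fun x => ⨅ q : ℚ, if pass q x then ((q : ℝ) : EReal) else ⊤ with hlo
  set hi : Ω → EReal := fun x => ⨆ q : ℚ, if pass q x then ((q : ℝ) : EReal) else ⊥ with hhi
  have mlo : Measurable lo := Measurable.iInf fun q =>
    Measurable.ite (hpass q) measurable_const measurable_const
  have mhi : Measurable hi := Measurable.iSup fun q =>
    Measurable.ite (hpass q) measurable_const measurable_const
  refine ⟨fun x => (lo x).toReal, fun x => max (lo x).toReal (hi x).toReal,
    mlo.ereal_toReal, mlo.ereal_toReal.max mhi.ereal_toReal, fun x => le_max_left _ _, ?_⟩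
  intro x θ ρ η hη hρ hin
  have hloq : ∀ q : ℚ, pass q x → lo x ≤ ((q : ℝ) : EReal) := fun q hq =>
    (iInf_le _ q).trans (by rw [if_pos hq])
  have hhiq : ∀ q : ℚ, pass q x → ((q : ℝ) : EReal) ≤ hi x := fun q hq =>
    le_trans (by rw [if_pos hq]) (le_iSup (fun q : ℚ => if pass q x then ((q : ℝ) : EReal) else ⊥) q)
  have hlo1 : ((θ - ρ : ℝ) : EReal) ≤ lo x := le_iInf fun q => by
    split_ifs with hq
    · have := (abs_le.1 (hρ q hq)).2
      exact EReal.coe_le_coe_iff.2 (by linarith)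
    · exact le_top
  have hhi1 : hi x ≤ ((θ + ρ : ℝ) : EReal) := iSup_le fun q => by
    split_ifs with hq
    · have := (abs_le.1 (hρ q hq)).1
      exact EReal.coe_le_coe_iff.2 (by linarith)
    · exact bot_le
  obtain ⟨q₀, hq₀, hq₀'⟩ := exists_rat_btwn (show θ < θ + η by linarith)
  have hp₀ : pass q₀ x := hin q₀ (abs_le.2 ⟨by linarith, by linarith⟩)
  have lo_ne_top : lo x ≠ ⊤ := ((hloq q₀ hp₀).trans_lt (EReal.coe_lt_top _)).ne
  have lo_ne_bot : lo x ≠ ⊥ := ((EReal.bot_lt_coe _).trans_le hlo1).ne'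
  have hi_ne_top : hi x ≠ ⊤ := (hhi1.trans_lt (EReal.coe_lt_top _)).ne
  have hi_ne_bot : hi x ≠ ⊥ := ((EReal.bot_lt_coe _).trans_le (hhiq q₀ hp₀)).ne'
  dsimp only
  generalize lo x = a at *
  generalize hi x = b at *
  lift a to ℝ using ⟨lo_ne_top, lo_ne_bot⟩
  lift b to ℝ using ⟨hi_ne_top, hi_ne_bot⟩
  simp only [EReal.coe_le_coe_iff, EReal.toReal_coe] at *
  have ha : a ≤ θ := by
    by_contra! hlt
    obtain ⟨q, hq1, hq2⟩ := exists_rat_btwn (show θ < min a (θ + η) from lt_min hlt (by linarith))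
    rw [lt_min_iff] at hq2
    linarith [hloq q (hin q (abs_le.2 ⟨by linarith, by linarith⟩))]
  have hb : θ ≤ b := by
    by_contra! hlt
    obtain ⟨q, hq1, hq2⟩ := exists_rat_btwn (show max b (θ - η) < θ from max_lt hlt (by linarith))
    rw [max_lt_iff] at hq1
    linarith [hhiq q (hin q (abs_le.2 ⟨by linarith, by linarith⟩))]
  refine ⟨ha, hb.trans (le_max_right _ _), ?_⟩
  rw [max_eq_right (ha.trans hb)]
  linarith

/-! ### The scale-free test of a candidate center -/

/-- The candidate `q` is accepted if a majority of the pilot sample `S` lies near `q` and no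
empirical contrast at `q` is significantly negative, all relative to the pilot scale
`minGap S x`. -/
def Accepted {n : ℕ} (S : Finset (Fin n)) (ρ κ A q : ℝ) (x : Fin n → ℝ) : Prop :=
  Majority S q (ρ * minGap S x) x ∧ ∀ k : ℤ, κ ≤ (3 / 2 : ℝ) ^ k * minGap S x →
    -(A * ((3 / 2 : ℝ) ^ k * minGap S x) / √n) ≤ empContrast Finset.univ ((3 / 2) ^ k) q x

theorem measurableSet_accepted {n : ℕ} (S : Finset (Fin n)) (ρ κ A q : ℝ) :
    MeasurableSet {x | Accepted S ρ κ A q x} := by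
  have hm := measurable_minGap S
  have h1 : MeasurableSet {x | Majority S q (ρ * minGap S x) x} := by
    have : {x | Majority S q (ρ * minGap S x) x} = ⋃ T ∈ S.powerset,
        {x | S.card < 2 * T.card ∧ ∀ i ∈ T, |x i - q| ≤ ρ * minGap S x} := by
      ext x; simp only [Majority, Set.mem_iUnion, Set.mem_ofPred_eq, exists_prop]
    rw [this]
    refine Finset.measurableSet_biUnion _ fun T _ => (MeasurableSet.const _).inter ?_
    have : {x : Fin n → ℝ | ∀ i ∈ T, |x i - q| ≤ ρ * minGap S x}
        = ⋂ i ∈ T, {x | |x i - q| ≤ ρ * minGap S x} := by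
      ext x; simp
    change MeasurableSet {x : Fin n → ℝ | ∀ i ∈ T, |x i - q| ≤ ρ * minGap S x}
    rw [this]
    exact Finset.measurableSet_biInter _ fun i _ =>
      measurableSet_le (by fun_prop) (hm.const_mul ρ)
  refine h1.inter ?_
  have : {x : Fin n → ℝ | ∀ k : ℤ, κ ≤ (3 / 2 : ℝ) ^ k * minGap S x →
      -(A * ((3 / 2 : ℝ) ^ k * minGap S x) / √n) ≤ empContrast Finset.univ ((3 / 2) ^ k) q x}
      = ⋂ k : ℤ, ({x | κ ≤ (3 / 2 : ℝ) ^ k * minGap S x}ᶜ ∪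
        {x | -(A * ((3 / 2 : ℝ) ^ k * minGap S x) / √n)
          ≤ empContrast Finset.univ ((3 / 2) ^ k) q x}) := by
    ext x; simp [imp_iff_not_or]
  change MeasurableSet {x : Fin n → ℝ | ∀ k : ℤ, κ ≤ (3 / 2 : ℝ) ^ k * minGap S x →
      -(A * ((3 / 2 : ℝ) ^ k * minGap S x) / √n) ≤ empContrast Finset.univ ((3 / 2) ^ k) q x}
  rw [this]
  exact MeasurableSet.iInter fun k =>
    (measurableSet_le measurable_const (hm.const_mul _)).compl.union
      (measurableSet_le ((((hm.const_mul _).const_mul _).div_const _).neg)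
        (measurable_empContrast _ _ _))

theorem le_zpow_of_le_mul_minGap {n : ℕ} {S : Finset (Fin n)} {σ κ t : ℝ} {x : Fin n → ℝ}
    (hσ : 0 < σ) (ht : 0 ≤ t) (hgap : minGap S x ≤ 8 * σ) (h : κ ≤ t * minGap S x) :
    κ / (8 * σ) ≤ t := by
  rw [div_le_iff₀ (by positivity)]
  exact h.trans (by gcongr)

/-- On the good event, candidates close to the true center are accepted. -/
theorem accepted_of_abs_sub_le {n : ℕ} {S : Finset (Fin n)} {θ σ ε c κ K q : ℝ} {Q : Measure ℝ}
    [IsProbabilityMeasure Q] {x : Fin n → ℝ} (hn : 0 < n) (hσ : 0 < σ) (h0 : 0 ≤ ε)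
    (h1 : ε ≤ 1 / 3) (hc : 0 < c) (hK : 0 ≤ K) (hmaj : Majority S θ (4 * σ) x)
    (hgap : c * σ ≤ minGap S x) (hgap' : minGap S x ≤ 8 * σ)
    (hgrid : GridClose (efron θ σ ε Q) Finset.univ (κ / (8 * σ)) (K * σ / √n) x)
    (hq : |q - θ| ≤ σ) (hq' : |q - θ| ≤ K * σ / (6 * √n)) :
    Accepted S (5 / c) κ (11 * K / c) q x := by
  have := isProbabilityMeasure_efron (θ := θ) (σ := σ) (Q := Q) h0 (by linarith)
  have hsn : 0 < √(n : ℝ) := Real.sqrt_pos.2 (by exact_mod_cast hn)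
  have huniv : (Finset.univ : Finset (Fin n)).Nonempty := ⟨⟨0, hn⟩, Finset.mem_univ _⟩
  refine ⟨hmaj.mono ?_, fun k hk => ?_⟩
  · calc 4 * σ + |q - θ| ≤ 5 / c * (c * σ) := by field_simp; linarith
      _ ≤ _ := by gcongr
  · have ht : 0 < (3 / 2 : ℝ) ^ k := by positivity
    obtain ⟨g1, g2⟩ := hgrid k (le_zpow_of_le_mul_minGap hσ ht.le hgap' hk)
    have h2 := (abs_le.1 (abs_empContrast_sub_cosContrast_le g1 g2 θ)).1
    have h3 := cosContrast_center_nonneg (θ := θ) (σ := σ) (Q := Q) h0 h1 ((3 / 2 : ℝ) ^ k)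
    have h4 := (abs_le.1 (abs_empContrast_sub_le huniv ht.le q θ x)).1
    generalize (3 / 2 : ℝ) ^ k = t at *
    have h5 : 6 * t * |q - θ| ≤ K * σ / √n * t := by
      calc 6 * t * |q - θ| ≤ 6 * t * (K * σ / (6 * √n)) := by gcongr
        _ = _ := by field_simp
    have h6 : 11 * (K * σ / √n * t) ≤ 11 * K / c * (t * minGap S x) / √n := by
      calc 11 * (K * σ / √n * t) = 11 * K / c * (t * (c * σ)) / √n := by field_simp
        _ ≤ _ := by gcongr
    linarith

/-- On the good event, accepted candidates are close to the true center. -/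
theorem Accepted.abs_sub_le {n : ℕ} {S : Finset (Fin n)} {θ σ ε c κ K q : ℝ} {Q : Measure ℝ}
    [IsProbabilityMeasure Q] {x : Fin n → ℝ} (h : Accepted S (5 / c) κ (11 * K / c) q x)
    (hn : 0 < n) (hσ : 0 < σ) (h0 : 0 ≤ ε) (h1 : ε ≤ 1 / 3) (hc : 0 < c) (hc1 : c ≤ 1)
    (hK : 0 ≤ K) (hκ : κ / c ≤ 1 / 8) (hκ' : κ / c * (44 / c) ≤ 1)
    (hnK : 10 * (98 * K / c) < (n : ℝ) ^ ((1 : ℝ) / 4)) (hmaj : Majority S θ (4 * σ) x)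
    (hgap : c * σ ≤ minGap S x) (hgap' : minGap S x ≤ 8 * σ)
    (hgrid : GridClose (efron θ σ ε Q) Finset.univ (κ / (8 * σ)) (K * σ / √n) x) :
    |θ - q| ≤ 8 * (161 + 64 * (98 * K / c)) * σ * ((n : ℝ) ^ (-(1 / 8 : ℝ)) +
      ε ^ ((1 : ℝ) / 4) / √(max 1 (log (exp 1 * n * ε ^ 2)))) := by
  have := isProbabilityMeasure_efron (θ := θ) (σ := σ) (Q := Q) h0 (by linarith)
  have hsn : 0 < √(n : ℝ) := Real.sqrt_pos.2 (by exact_mod_cast hn)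
  obtain ⟨hm, hk⟩ := h
  refine abs_sub_le_of_cosContrast_ge (Q := Q) (R := 44 / c) hσ h0 h1 (by positivity) hκ hκ' ?_
    (by exact_mod_cast hn) hnK fun k hkκ => ?_
  · refine (hm.exists_mem_mem hmaj).trans ?_
    calc 5 / c * minGap S x + 4 * σ ≤ 5 / c * (8 * σ) + 4 / c * σ := by
          have : 4 ≤ 4 / c := by rw [le_div_iff₀ hc]; linarith
          gcongr
      _ = _ := by ring
  · have ht : 0 < (3 / 2 : ℝ) ^ k := by positivity
    have hks : κ ≤ (3 / 2 : ℝ) ^ k * minGap S x := by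
      rw [div_le_iff₀ hc] at hkκ
      refine hkκ.trans ?_
      calc _ = (3 / 2 : ℝ) ^ k * (c * σ) := by ring
        _ ≤ _ := by gcongr
    obtain ⟨g1, g2⟩ := hgrid k (le_zpow_of_le_mul_minGap hσ ht.le hgap' hks)
    have h2 := (abs_le.1 (abs_empContrast_sub_cosContrast_le g1 g2 q)).2
    have h3 := hk k hks
    generalize (3 / 2 : ℝ) ^ k = t at *
    have h4 : 11 * K / c * (t * minGap S x) / √n ≤ 88 * K / c * (t * σ) / √n := by
      calc _ ≤ 11 * K / c * (t * (8 * σ)) / √n := by gcongr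
        _ = _ := by ring
    have h5 : 10 * (K * σ / √n * t) ≤ 10 * K / c * (t * σ) / √n := by
      have : 10 * K ≤ 10 * K / c := le_div_self (by positivity) hc hc1
      calc 10 * (K * σ / √n * t) = 10 * K * (t * σ) / √n := by ring
        _ ≤ _ := by gcongr
    have h6 : 98 * K / c * (t * σ) / √n = 88 * K / c * (t * σ) / √n + 10 * K / c * (t * σ) / √n := by
      ring
    linarith

/-- The good event has probability at least `1 - 3 * (δ / 4)`. -/
theorem iid_not_good_le {n : ℕ} {S : Finset (Fin n)} {θ σ ε c κ K δ : ℝ} {Q : Measure ℝ}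
    [IsProbabilityMeasure Q] (hn : 0 < n) (hσ : 0 < σ) (h0 : 0 ≤ ε) (h1 : ε ≤ 1 / 3)
    (hδ : 0 ≤ δ) (hS : 2 ≤ S.card) (hκ : 0 < κ) (hK : 0 < K) (h64 : 64 / (S.card : ℝ) ≤ δ / 4)
    (hc : (S.card : ℝ) ^ 2 * c ≤ δ / 4) (hKκ : 512 / (K ^ 2 * κ ^ 2) ≤ δ / 4) :
    iid n (efron θ σ ε Q) {x | ¬ (Majority S θ (4 * σ) x ∧ c * σ ≤ minGap S x ∧
      minGap S x ≤ 8 * σ ∧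
      GridClose (efron θ σ ε Q) Finset.univ (κ / (8 * σ)) (K * σ / √n) x)}
      ≤ ENNReal.ofReal δ := by
  have := isProbabilityMeasure_efron (θ := θ) (σ := σ) (Q := Q) h0 (by linarith)
  have hsn : 0 < √(n : ℝ) := Real.sqrt_pos.2 (by exact_mod_cast hn)
  have huniv : (Finset.univ : Finset (Fin n)).Nonempty := ⟨⟨0, hn⟩, Finset.mem_univ _⟩
  have b1 := iid_not_majority (θ := θ) (Q := Q) hσ h0 h1 (S := S)
    (Finset.card_pos.1 (by omega))
  have b2 := iid_exists_close_pair (θ := θ) (Q := Q) hσ h0 (by linarith) S c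
  have b3 := iid_not_gridClose (efron θ σ ε Q) huniv (c := κ / (8 * σ)) (τ := K * σ / √n)
    (by positivity) (by positivity)
  have heq : 8 / (((Finset.univ : Finset (Fin n)).card : ℝ) * (K * σ / √n) ^ 2 *
      (κ / (8 * σ)) ^ 2) = 512 / (K ^ 2 * κ ^ 2) := by
    have hn' : (n : ℝ) ≠ 0 := by positivity
    rw [Finset.card_univ, Fintype.card_fin, div_pow (K * σ), Real.sq_sqrt (Nat.cast_nonneg n)]
    field_simp
    norm_num
  rw [heq] at b3
  have hsub : {x : Fin n → ℝ | ¬ (Majority S θ (4 * σ) x ∧ c * σ ≤ minGap S x ∧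
      minGap S x ≤ 8 * σ ∧
      GridClose (efron θ σ ε Q) Finset.univ (κ / (8 * σ)) (K * σ / √n) x)} ⊆
      {x | ¬ Majority S θ (4 * σ) x} ∪ {x | ∃ p ∈ S.offDiag, |x p.1 - x p.2| ≤ c * σ} ∪
      {x | ¬ GridClose (efron θ σ ε Q) Finset.univ (κ / (8 * σ)) (K * σ / √n) x} := by
    intro x hx
    by_contra hcon
    simp only [Set.mem_union, Set.mem_ofPred_eq, not_or, not_not] at hcon
    obtain ⟨⟨hm, hp⟩, hg⟩ := hcon
    exact hx ⟨hm, le_minGap hS hp, (minGap_le hS hm).trans (by linarith), hg⟩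
  refine (measure_mono hsub).trans ((measure_union_le _ _).trans
    ((add_le_add (measure_union_le _ _) le_rfl).trans
    ((add_le_add (add_le_add b1 b2) b3).trans ?_)))
  calc _ ≤ ENNReal.ofReal (δ / 4) + ENNReal.ofReal (δ / 4) + ENNReal.ofReal (δ / 4) := by gcongr
    _ = ENNReal.ofReal (δ / 4 + δ / 4 + δ / 4) := by
      rw [ENNReal.ofReal_add (by positivity) (by positivity),
        ENNReal.ofReal_add (by positivity) (by positivity)]
    _ ≤ _ := ENNReal.ofReal_le_ofReal (by linarith)

/-- Unknown-variance upper bound (Theorem 4.2): for `εmax ∈ (0,1/3]` there is a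
confidence-interval procedure, not depending on `σ`, adaptive to unknown `ε` and `σ²`,
with coverage `1-δ` and length at most
`C·σ·(n^{-1/8} + ε^{1/4}/√(max 1 (log(e n ε²))))`. -/
theorem unknownVariance_upper_bound (δ εmax : ℝ)
    (hδ : δ ∈ Set.Ioo (0:ℝ) 1) (hεm : εmax ∈ Set.Ioc (0:ℝ) (1/3)) :
    ∃ (C : ℝ) (N : ℕ), 0 < C ∧ 1 ≤ N ∧
      ∀ n : ℕ, N ≤ n →
        ∃ l u : (Fin n → ℝ) → ℝ,
          Measurable l ∧ Measurable u ∧ (∀ x, l x ≤ u x) ∧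
          ∀ (θ σ ε : ℝ), 0 < σ → ε ∈ Set.Icc 0 εmax →
            ∀ Q : Measure ℝ, IsProbabilityMeasure Q →
              ENNReal.ofReal (1 - δ) ≤
                iid n (efron θ σ ε Q)
                  {x | l x ≤ θ ∧ θ ≤ u x ∧
                    u x - l x ≤ C * σ * ((n : ℝ) ^ (-(1/8 : ℝ)) +
                      ε ^ ((1:ℝ)/4) /
                        Real.sqrt (max 1 (Real.log (Real.exp 1 * n * ε ^ 2))))} := by
  obtain ⟨hδ0, hδ1⟩ := hδ
  obtain ⟨m, hm⟩ := exists_nat_ge (256 / δ)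
  have hm256 : (256 : ℝ) ≤ m := by
    refine le_trans ?_ hm
    rw [le_div_iff₀ hδ0]; linarith
  have hm0 : (0 : ℝ) < m := by linarith
  have hm2 : 2 ≤ m := by
    have : (2 : ℝ) ≤ m := by linarith
    exact_mod_cast this
  obtain ⟨c, hc⟩ : ∃ c, c = δ / (4 * (m : ℝ) ^ 2) := ⟨_, rfl⟩
  have hc0 : 0 < c := by rw [hc]; positivity
  have hmc : (m : ℝ) ^ 2 * c = δ / 4 := by rw [hc]; field_simp
  have hc1 : c ≤ 1 := by
    have : 1 ≤ (m : ℝ) ^ 2 := one_le_pow₀ (by linarith)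
    nlinarith
  obtain ⟨κ, hκ⟩ : ∃ κ, κ = c ^ 2 / 44 := ⟨_, rfl⟩
  have hκ0 : 0 < κ := by rw [hκ]; positivity
  have hκc : κ / c = c / 44 := by rw [hκ]; field_simp
  obtain ⟨K, hK⟩ : ∃ K, K = 48 / (δ * κ) := ⟨_, rfl⟩
  have hK0 : 0 < K := by rw [hK]; positivity
  have hKκ : 512 / (K ^ 2 * κ ^ 2) ≤ δ / 4 := by
    have : K ^ 2 * κ ^ 2 = 48 ^ 2 / δ ^ 2 := by rw [hK]; field_simp
    rw [this, div_le_iff₀ (by positivity)]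
    field_simp
    linarith
  obtain ⟨M, hM⟩ := exists_nat_gt ((10 * (98 * K / c)) ^ 4)
  refine ⟨2 * (8 * (161 + 64 * (98 * K / c))), max m M, by positivity,
    (by omega : 1 ≤ m).trans (le_max_left _ _), fun n hn => ?_⟩
  have hmn : m ≤ n := (le_max_left _ _).trans hn
  have hMn : M ≤ n := (le_max_right _ _).trans hn
  have hn0 : 0 < n := by omega
  have hnK : 10 * (98 * K / c) < (n : ℝ) ^ ((1 : ℝ) / 4) := by
    refine lt_of_pow_lt_pow_left₀ 4 (by positivity) ?_
    rw [← Real.rpow_natCast ((n : ℝ) ^ ((1 : ℝ) / 4)), ← Real.rpow_mul (Nat.cast_nonneg n)]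
    norm_num at hM ⊢
    exact hM.trans_le (by exact_mod_cast hMn)
  obtain ⟨S, hS⟩ : ∃ S : Finset (Fin n), S.card = m :=
    (Finset.exists_subset_card_eq (s := (Finset.univ : Finset (Fin n))) (by simpa using hmn)).imp
      fun S h => h.2
  obtain ⟨l, u, hl, hu, hlu, hhull⟩ := exists_measurable_hull
    (fun (q : ℚ) => Accepted S (5 / c) κ (11 * K / c) q)
    fun q => measurableSet_accepted S (5 / c) κ (11 * K / c) q
  refine ⟨l, u, hl, hu, hlu, fun θ σ ε hσ hε Q hQ => ?_⟩
  have h0 : 0 ≤ ε := hε.1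
  have h1 : ε ≤ 1 / 3 := hε.2.trans hεm.2
  have := isProbabilityMeasure_efron (θ := θ) (σ := σ) (Q := Q) h0 (by linarith)
  have : IsProbabilityMeasure (iid n (efron θ σ ε Q)) := by unfold iid; infer_instance
  have hbad := iid_not_good_le (θ := θ) (Q := Q) (S := S) hn0 hσ h0 h1 hδ0.le (hS ▸ hm2) hκ0 hK0
    (by rw [hS, div_le_iff₀ hm0]; rw [div_le_iff₀ hδ0] at hm; linarith)
    (by rw [hS]; exact hmc.le) hKκ
  rw [ENNReal.ofReal_sub _ hδ0.le, ENNReal.ofReal_one, tsub_le_iff_right,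
    ← measure_univ (μ := iid n (efron θ σ ε Q))]
  refine le_trans (measure_mono ?_) ((measure_union_le _ _).trans (add_le_add le_rfl hbad))
  intro x _
  by_cases hx : Majority S θ (4 * σ) x ∧ c * σ ≤ minGap S x ∧ minGap S x ≤ 8 * σ ∧
      GridClose (efron θ σ ε Q) Finset.univ (κ / (8 * σ)) (K * σ / √n) x
  · obtain ⟨hmaj, hgap, hgap', hgrid⟩ := hx
    have hsn : 0 < √(n : ℝ) := Real.sqrt_pos.2 (by exact_mod_cast hn0)
    have hfin := hhull x θ _ (min σ (K * σ / (6 * √n))) (by positivity)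
      (fun q hq => hq.abs_sub_le hn0 hσ h0 h1 hc0 hc1 hK0.le (by rw [hκc]; linarith)
        (by rw [hκc]; field_simp; norm_num) hnK hmaj hgap hgap' hgrid)
      fun q hq => accepted_of_abs_sub_le hn0 hσ h0 h1 hc0 hK0.le hmaj hgap hgap' hgrid
        (hq.trans (min_le_left _ _)) (hq.trans (min_le_right _ _))
    exact Or.inl ⟨hfin.1, hfin.2.1, hfin.2.2.trans (le_of_eq (by ring))⟩
  · exact Or.inr hx
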